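/- Fix ε > 0 and assume the sieve setup. If sup_d |λ_d| ≤ (log X)^{k/2}, then |∑_{X < n ≤ 2X, n ≡ v0 (mod W)} w_n − (X/W) · ∑_{d,e} λ_d λ_e ∏_{p | de} ν(p)/p| ≤ C(ε) · X^{1/5 + ε}, where the sums over d, e range over the support of λ, the product is over primes p dividing d·e, and C(ε) depends only on ε. -/

import Mathlib

/-- `⟨P3⟩`: positive integers all of whose prime factors are `≡ 3 (mod 4)` (contains 1). -/
def InP3 (n : ℕ) : Prop := ∀ p : ℕ, p.Prime → p ∣ n → p % 4 = 3

lemma card_crt (m n : ℕ) (hm : 0 < m) (hn : 0 < n) (h : m.Coprime n) (A B : ℕ → Prop) [DecidablePred A] [DecidablePred B]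
    (hA : ∀ x, A (x % m) ↔ A x) (hB : ∀ x, B (x % n) ↔ B x) :
    ((Finset.range (m*n)).filter (fun x => A x ∧ B x)).card =
      ((Finset.range m).filter A).card * ((Finset.range n).filter B).card := by
  rw [← Finset.card_product]
  apply Finset.card_bij (fun x _ => (x % m, x % n))
  · intro x hx
    simp only [Finset.mem_filter, Finset.mem_range, Finset.mem_product] at hx ⊢
    exact ⟨⟨Nat.mod_lt _ hm, (hA x).2 hx.2.1⟩, Nat.mod_lt _ hn, (hB x).2 hx.2.2⟩
  · intro x hx y hy hxy
    simp only [Finset.mem_filter, Finset.mem_range, Prod.mk.injEq] at hx hy hxy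
    have := (Nat.modEq_and_modEq_iff_modEq_mul h).1 ⟨hxy.1, hxy.2⟩
    exact Nat.ModEq.eq_of_lt_of_lt this hx.1 hy.1
  · rintro ⟨u, v⟩ huv
    simp only [Finset.mem_filter, Finset.mem_range, Finset.mem_product] at huv
    obtain ⟨⟨hu, hAu⟩, hv, hBv⟩ := huv
    have h1 := (Nat.chineseRemainder h u v).2.1
    have h2 := (Nat.chineseRemainder h u v).2.2
    have h3 := Nat.chineseRemainder_lt_mul h u v hm.ne' hn.ne'
    set x : ℕ := (Nat.chineseRemainder h u v : ℕ)
    have e1 : x % m = u := by rw [h1, Nat.mod_eq_of_lt hu]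
    have e2 : x % n = v := by rw [h2, Nat.mod_eq_of_lt hv]
    refine ⟨x, ?_, by simp [e1, e2]⟩
    simp only [Finset.mem_filter, Finset.mem_range]
    exact ⟨h3, (hA x).1 (e1 ▸ hAu), (hB x).1 (e2 ▸ hBv)⟩

lemma card_primes (P : ℤ → ℤ) (hP : ∀ (m : ℤ) x y, x ≡ y [ZMOD m] → P x ≡ P y [ZMOD m])
    (s : Finset ℕ) (hs : ∀ p ∈ s, p.Prime) :
    ((Finset.range (∏ p ∈ s, p)).filter (fun x : ℕ => ∀ p ∈ s, (p:ℤ) ∣ P x)).card =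
      ∏ p ∈ s, ((Finset.range p).filter (fun x : ℕ => (p:ℤ) ∣ P x)).card := by
  classical
  have per : ∀ (m p x : ℕ), p ∣ m → ((p:ℤ) ∣ P ((x % m : ℕ)) ↔ (p:ℤ) ∣ P x) := by
    intro m p x hpm
    have : ((x % m : ℕ) : ℤ) ≡ x [ZMOD p] := by
      rw [Int.natCast_modEq_iff]
      exact (Nat.mod_modEq x m).of_dvd hpm
    have := hP _ _ _ this
    exact this.dvd_iff
  induction s using Finset.induction_on with
  | empty => simp
  | insert q s hq ih =>
    rw [Finset.prod_insert hq, Finset.prod_insert hq, ← ih (fun p hp => hs p (Finset.mem_insert_of_mem hp)),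
      ← card_crt]
    · simp only [Finset.forall_mem_insert]
    · exact (hs q (by simp)).pos
    · exact Finset.prod_pos (fun p hp => (hs p (by simp [hp])).pos)
    · apply Nat.Coprime.prod_right
      intro p hp
      rw [Nat.coprime_primes (hs q (by simp)) (hs p (by simp [hp]))]
      rintro rfl; exact hq hp
    · intro x; exact per _ _ _ dvd_rfl
    · intro x
      exact forall₂_congr (fun p hp => per _ _ _ (Finset.dvd_prod_of_mem _ hp))

lemma count_one (X : ℝ) (hX : 0 ≤ X) (q : ℕ) (hq : 0 < q) (r : ℤ) :
    |(((Finset.Icc (⌊X⌋ + 1) ⌊2 * X⌋).filter (fun n => n ≡ r [ZMOD q])).card : ℝ) - X / q| ≤ 1 := by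
  have hI : Finset.Icc (⌊X⌋ + 1) ⌊2 * X⌋ = Finset.Ioc ⌊X⌋ ⌊2*X⌋ := by
    ext; simp
  have hq' : (0:ℤ) < q := by exact_mod_cast hq
  have hqr : (0:ℝ) < q := by exact_mod_cast hq
  have := Int.Ioc_filter_modEq_card ⌊X⌋ ⌊2*X⌋ hq' r
  rw [hI]
  have fl : ∀ Y : ℝ, ⌊((⌊Y⌋ - r : ℤ) : ℚ) / ((q:ℤ):ℚ)⌋ = ⌊(Y - r) / q⌋ := by
    intro Y
    have : ⌊(Y - r) / q⌋ = ⌊Y - r⌋ / (q:ℤ) := Int.floor_div_natCast _ _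
    rw [this, Int.floor_sub_intCast]
    exact_mod_cast Rat.floor_intCast_div_natCast _ _
  push_cast at this fl
  rw [fl, fl] at this
  have h2 : (((Finset.Ioc ⌊X⌋ ⌊2*X⌋).filter (fun n => n ≡ r [ZMOD q])).card : ℝ) = 
     ((max (⌊(2*X - r) / q⌋ - ⌊(X - r) / q⌋) 0 : ℤ) : ℝ) := by exact_mod_cast this
  have hle : ⌊(X - r) / q⌋ ≤ ⌊(2*X - r) / q⌋ := by
    apply Int.floor_le_floor; gcongr; linarith
  rw [max_eq_left (by linarith)] at h2
  rw [h2]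
  push_cast
  have a1 := Int.floor_le ((X - r) / q)
  have a2 := Int.lt_floor_add_one ((X - r) / q)
  have a3 := Int.floor_le ((2*X - r) / q)
  have a4 := Int.lt_floor_add_one ((2*X - r) / q)
  have e : (2*X - r)/q = (X-r)/q + X/q := by ring
  rw [abs_le]; constructor <;> linarith

lemma count_periodic (X : ℝ) (hX : 0 ≤ X) (q : ℕ) (hq : 0 < q) (Q : ℤ → Prop) [DecidablePred Q]
    (hQ : ∀ x y : ℤ, x ≡ y [ZMOD q] → (Q x ↔ Q y)) :
    |(((Finset.Icc (⌊X⌋ + 1) ⌊2 * X⌋).filter Q).card : ℝ) -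
      X / q * ((Finset.range q).filter (fun x : ℕ => Q x)).card| ≤
      ((Finset.range q).filter (fun x : ℕ => Q x)).card := by
  have hq' : (0:ℤ) < q := by exact_mod_cast hq
  have key : ((Finset.Icc (⌊X⌋ + 1) ⌊2 * X⌋).filter Q).card =
     ∑ r ∈ (Finset.range q).filter (fun x : ℕ => Q x),
      ((Finset.Icc (⌊X⌋ + 1) ⌊2 * X⌋).filter (fun n => n ≡ (r:ℤ) [ZMOD q])).card := by
    rw [Finset.card_eq_sum_card_fiberwise (f := fun n : ℤ => (n % q).toNat)
      (t := (Finset.range q).filter (fun x : ℕ => Q x))]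
    · apply Finset.sum_congr rfl
      intro r hr
      simp only [Finset.mem_filter, Finset.mem_range] at hr
      congr 1
      rw [Finset.filter_filter]
      apply Finset.filter_congr
      intro n _
      have e0 := Int.emod_nonneg n hq'.ne'
      have e1 : (r:ℤ) % q = r := Int.emod_eq_of_lt (by positivity) (by exact_mod_cast hr.1)
      constructor
      · rintro ⟨_, h⟩
        unfold Int.ModEq
        rw [e1]; omega
      · intro h
        refine ⟨(hQ _ _ h).2 hr.2, ?_⟩
        unfold Int.ModEq at h
        rw [e1] at h; omega
    · intro n hn
      simp only [Finset.coe_filter, Set.mem_ofPred_eq, Finset.mem_range] at hn ⊢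
      have e0 := Int.emod_nonneg n hq'.ne'
      have e2 := Int.emod_lt_of_pos n hq'
      refine ⟨by omega, ?_⟩
      rw [Int.toNat_of_nonneg e0]
      exact (hQ _ _ (Int.mod_modEq n q)).2 hn.2
  rw [key]
  push_cast
  rw [mul_comm (X / (q:ℝ)), ← nsmul_eq_mul, ← Finset.sum_const, ← Finset.sum_sub_distrib]
  refine (Finset.abs_sum_le_sum_abs _ _).trans ?_
  refine (Finset.sum_le_sum (fun (r : ℕ) _ => count_one X hX q hq (r : ℤ))).trans ?_
  simp

lemma pow_omega (k : ℝ) (d : ℕ) (hd : Squarefree d) :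
    (k + 1) ^ d.primeFactors.card = ∑ e ∈ d.divisors, k ^ e.primeFactors.card := by
  let f : ArithmeticFunction ℝ := ⟨fun n => if n = 0 then 0 else k ^ n.primeFactors.card, by simp⟩
  have hf : ∀ n, n ≠ 0 → f n = k ^ n.primeFactors.card := fun n hn => by
    show (if n = 0 then 0 else k ^ n.primeFactors.card) = _
    simp [hn]
  have hm : f.IsMultiplicative := by
    rw [ArithmeticFunction.IsMultiplicative.iff_ne_zero]
    refine ⟨by simp [hf 1 one_ne_zero], ?_⟩
    intro m n hm hn hc
    rw [hf _ (mul_ne_zero hm hn), hf _ hm, hf _ hn, hc.primeFactors_mul,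
      Finset.card_union_of_disjoint hc.disjoint_primeFactors, pow_add]
  have h := hm.prodPrimeFactors_one_add_of_squarefree hd
  rw [Finset.sum_congr rfl (fun e he => (hf e (Nat.pos_of_mem_divisors he).ne').symm), ← h,
    ← Finset.prod_const]
  apply Finset.prod_congr rfl
  intro p hp
  have hp' := Nat.prime_of_mem_primeFactors hp
  rw [hf p hp'.ne_zero, hp'.primeFactors]
  simp [add_comm]

lemma sum_inv_mult (D e : ℕ) (he : 0 < e) :
    ∑ d ∈ (Finset.Icc 1 D).filter (fun d => e ∣ d), (1 : ℝ) / d ≤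
      1 / e * ∑ d ∈ Finset.Icc 1 D, (1 : ℝ) / d := by
  have hinj : Set.InjOn (fun x => e * x) (Finset.Icc 1 D : Set ℕ) := by
    intro x _ y _ h
    exact Nat.eq_of_mul_eq_mul_left he h
  have : ∑ d ∈ (Finset.Icc 1 D).filter (fun d => e ∣ d), (1 : ℝ) / d ≤
      ∑ d ∈ (Finset.Icc 1 D).image (fun x => e * x), (1 : ℝ) / d := by
    apply Finset.sum_le_sum_of_subset_of_nonneg
    · intro d hd
      simp only [Finset.mem_filter, Finset.mem_Icc, Finset.mem_image] at hd ⊢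
      obtain ⟨⟨h1, h2⟩, f, rfl⟩ := hd
      refine ⟨f, ⟨?_, ?_⟩, rfl⟩
      · exact Nat.pos_of_ne_zero (by rintro rfl; simp at h1)
      · exact (Nat.le_mul_of_pos_left f he).trans h2
    · intros; positivity
  refine this.trans ?_
  rw [Finset.sum_image hinj, Finset.mul_sum]
  apply le_of_eq
  apply Finset.sum_congr rfl
  intro x _
  push_cast
  rw [one_div_mul_one_div]

lemma sum_omega_div (D k : ℕ) :
    ∑ d ∈ (Finset.Icc 1 D).filter Squarefree, (k : ℝ) ^ d.primeFactors.card / d ≤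
      (∑ d ∈ Finset.Icc 1 D, (1 : ℝ) / d) ^ k := by
  induction k with
  | zero =>
    rw [pow_zero]
    have : ∀ d ∈ (Finset.Icc 1 D).filter Squarefree, d ≠ 1 →
       ((0:ℕ) : ℝ) ^ d.primeFactors.card / d = 0 := by
      intro d hd h1
      simp only [Finset.mem_filter, Finset.mem_Icc] at hd
      have : d.primeFactors.card ≠ 0 := by
        rw [Finset.card_ne_zero]
        exact Nat.nonempty_primeFactors.2 (by omega)
      simp [zero_pow this]
    by_cases h : 1 ∈ (Finset.Icc 1 D).filter Squarefree
    · rw [Finset.sum_eq_single_of_mem 1 h this]; simp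
    · rw [Finset.sum_eq_zero]; · simp
      intro d hd
      exact this d hd (by rintro rfl; exact h hd)
  | succ k ih =>
    set H := ∑ d ∈ Finset.Icc 1 D, (1 : ℝ) / d
    have hH : 0 ≤ H := Finset.sum_nonneg (fun _ _ => by positivity)
    calc _ = ∑ d ∈ (Finset.Icc 1 D).filter Squarefree,
          ∑ e ∈ ((Finset.Icc 1 D).filter Squarefree).filter (fun e => e ∣ d), 
            (k:ℝ) ^ e.primeFactors.card / d := by
          apply Finset.sum_congr rfl
          intro d hd
          simp only [Finset.mem_filter, Finset.mem_Icc] at hd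
          push_cast
          rw [pow_omega _ _ hd.2, Finset.sum_div]
          apply Finset.sum_congr _ (fun _ _ => rfl)
          ext e
          simp only [Finset.mem_filter, Finset.mem_Icc, Nat.mem_divisors]
          constructor
          · rintro ⟨h1, h2⟩
            exact ⟨⟨⟨Nat.pos_of_dvd_of_pos h1 (by omega), (Nat.le_of_dvd (by omega) h1).trans hd.1.2⟩,
              hd.2.squarefree_of_dvd h1⟩, h1⟩
          · rintro ⟨_, h1⟩
            exact ⟨h1, by omega⟩
      _ = ∑ e ∈ (Finset.Icc 1 D).filter Squarefree, (k:ℝ) ^ e.primeFactors.card *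
          ∑ d ∈ ((Finset.Icc 1 D).filter Squarefree).filter (fun d => e ∣ d), (1:ℝ) / d := by
          simp_rw [Finset.mul_sum]
          simp_rw [Finset.sum_filter (fun e => e ∣ _), Finset.sum_filter (fun d => _ ∣ d)]
          rw [Finset.sum_comm]
          simp [div_eq_mul_inv]
      _ ≤ ∑ e ∈ (Finset.Icc 1 D).filter Squarefree, (k:ℝ) ^ e.primeFactors.card *
          (1 / e * H) := by
          apply Finset.sum_le_sum
          intro e he
          simp only [Finset.mem_filter, Finset.mem_Icc] at he
          gcongr
          refine le_trans ?_ (sum_inv_mult D e (by omega))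
          apply Finset.sum_le_sum_of_subset_of_nonneg
          · exact Finset.filter_subset_filter _ (Finset.filter_subset _ _)
          · intros; positivity
      _ = (∑ e ∈ (Finset.Icc 1 D).filter Squarefree, (k:ℝ) ^ e.primeFactors.card / e) * H := by
          rw [Finset.sum_mul]
          apply Finset.sum_congr rfl; intros; ring
      _ ≤ H ^ k * H := by gcongr
      _ = _ := (pow_succ _ _).symm

lemma sum_omega (D k : ℕ) :
    ∑ d ∈ (Finset.Icc 1 D).filter Squarefree, (k : ℝ) ^ d.primeFactors.card ≤
      D * (1 + Real.log D) ^ k := by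
  have h1 : ∑ d ∈ Finset.Icc 1 D, (1 : ℝ) / d ≤ 1 + Real.log D := by
    have := harmonic_le_one_add_log D
    rw [harmonic_eq_sum_Icc] at this
    push_cast at this
    simpa using this
  calc _ ≤ ∑ d ∈ (Finset.Icc 1 D).filter Squarefree, D * ((k : ℝ) ^ d.primeFactors.card / d) := by
        apply Finset.sum_le_sum
        intro d hd
        simp only [Finset.mem_filter, Finset.mem_Icc] at hd
        have h0 : (0:ℝ) < d := by exact_mod_cast hd.1.1
        have h2 : (d:ℝ) ≤ D := by exact_mod_cast hd.1.2
        rw [← mul_div_assoc, le_div_iff₀ h0, mul_comm]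
        gcongr
    _ ≤ _ := by
        rw [← Finset.mul_sum]
        gcongr
        refine (sum_omega_div D k).trans ?_
        gcongr

lemma analytic (ε : ℝ) (hε : 0 < ε) : ∃ X0 : ℝ, 1 ≤ X0 ∧ ∀ X ≥ X0, 1 ≤ Real.log X ∧ ∀ k : ℕ,
    (k : ℝ) ≤ Real.log X ^ ((1 : ℝ) / 5) →
    Real.log X ^ k * ((1 + Real.log X) ^ k) ^ 2 ≤ X ^ ε := by
  have h1 : ∀ᶠ L : ℝ in Filter.atTop, 3 * L ^ ((1:ℝ)/5) * Real.log (2 * L) ≤ ε * L := by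
    have a := isLittleO_log_rpow_atTop (r := 1/5) (by norm_num)
    have a2 : Filter.Tendsto (fun L : ℝ => 2 * L) Filter.atTop Filter.atTop :=
      Filter.tendsto_id.const_mul_atTop (by norm_num)
    have a3 := (a.comp_tendsto a2).bound (c := 1) (by norm_num)
    have b3 := (tendsto_rpow_atTop (show (0:ℝ) < 3/5 by norm_num)).eventually_ge_atTop (6 / ε)
    filter_upwards [a3, b3, Filter.eventually_ge_atTop 1] with L h1 h2 hL
    simp only [Function.comp, Real.norm_eq_abs, one_mul] at h1
    have hL0 : 0 ≤ L := by linarith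
    rw [abs_of_nonneg (Real.log_nonneg (by linarith)), abs_of_nonneg (by positivity),
      Real.mul_rpow (by norm_num) hL0] at h1
    have h6 : L ^ ((2:ℝ)/5) * L ^ ((3:ℝ)/5) = L := by
      rw [← Real.rpow_add (by linarith)]; norm_num
    have h7 : 6 * L ^ ((2:ℝ)/5) ≤ ε * L := by
      rw [div_le_iff₀ hε] at h2
      have h8 : 0 ≤ L ^ ((2:ℝ)/5) := by positivity
      calc _ ≤ (L ^ ((3:ℝ)/5) * ε) * L ^ ((2:ℝ)/5) := by gcongr
        _ = ε * (L ^ ((2:ℝ)/5) * L ^ ((3:ℝ)/5)) := by ring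
        _ = _ := by rw [h6]
    have h3 : (2:ℝ) ^ ((1:ℝ)/5) ≤ 2 := by
      conv_rhs => rw [← Real.rpow_one 2]
      apply Real.rpow_le_rpow_of_exponent_le <;> norm_num
    have h4 : L ^ ((2:ℝ)/5) = L ^ ((1:ℝ)/5) * L ^ ((1:ℝ)/5) := by
      rw [← Real.rpow_add (by linarith)]; norm_num
    have h5 : 0 ≤ L ^ ((1:ℝ)/5) := by positivity
    calc _ ≤ 3 * L ^ ((1:ℝ)/5) * (2 * L ^ ((1:ℝ)/5)) := by
          gcongr; exact h1.trans (by gcongr)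
      _ ≤ _ := by nlinarith
  have h2 := Real.tendsto_log_atTop.eventually (h1.and (Filter.eventually_ge_atTop 1))
  obtain ⟨X0, h⟩ := Filter.eventually_atTop.1 h2
  refine ⟨max X0 1, le_max_right _ _, fun X hX => ?_⟩
  obtain ⟨h3, h4⟩ := h X ((le_max_left _ _).trans hX)
  refine ⟨h4, fun k hk => ?_⟩
  have hX0 : 0 < X := by linarith [(le_max_right X0 1).trans hX]
  set L := Real.log X with hL
  have hl : 0 ≤ Real.log (2 * L) := Real.log_nonneg (by linarith)
  calc _ ≤ (2 * L) ^ k * ((2 * L) ^ k) ^ 2 := by gcongr <;> linarith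
    _ = (2 * L) ^ (3 * k) := by ring
    _ = Real.exp (Real.log (2 * L) * (3 * k)) := by
        rw [← Real.rpow_natCast, Real.rpow_def_of_pos (by linarith)]; push_cast; rfl
    _ ≤ Real.exp (L * ε) := by
        apply Real.exp_le_exp.2
        calc _ = 3 * (k:ℝ) * Real.log (2 * L) := by ring
          _ ≤ 3 * L ^ ((1:ℝ)/5) * Real.log (2 * L) := by gcongr
          _ ≤ _ := by linarith
    _ = _ := by rw [Real.rpow_def_of_pos hX0]

lemma pair_count (X : ℝ) (hX : 0 ≤ X) (P : ℤ → ℤ)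
    (hP : ∀ (m : ℤ) x y, x ≡ y [ZMOD m] → P x ≡ P y [ZMOD m])
    (s : Finset ℕ) (hs : ∀ p ∈ s, p.Prime) (W : ℕ) (hW : 0 < W) (hsW : ∀ p ∈ s, p.Coprime W) (v0 : ℤ) :
    |(((Finset.Icc (⌊X⌋ + 1) ⌊2 * X⌋).filter
        (fun n => n % (W:ℤ) = v0 % (W:ℤ) ∧ ∀ p ∈ s, (p:ℤ) ∣ P n)).card : ℝ) -
      X / W * ∏ p ∈ s, (((Finset.range p).filter (fun x : ℕ => (p:ℤ) ∣ P x)).card : ℝ) / p| ≤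
      ∏ p ∈ s, (((Finset.range p).filter (fun x : ℕ => (p:ℤ) ∣ P x)).card : ℝ) := by
  classical
  set m := ∏ p ∈ s, p with hm
  have hm0 : 0 < m := Finset.prod_pos (fun p hp => (hs p hp).pos)
  have hWz : (0:ℤ) < W := by exact_mod_cast hW
  have h := count_periodic X hX (W * m) (by positivity)
    (fun n => n % (W:ℤ) = v0 % (W:ℤ) ∧ ∀ p ∈ s, (p:ℤ) ∣ P n) (by
      intro x y hxy
      push_cast at hxy
      have h1 : x % (W:ℤ) = y % (W:ℤ) := hxy.of_mul_right _
      have h2 : x ≡ y [ZMOD m] := hxy.of_mul_left _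
      rw [h1]
      refine and_congr_right (fun _ => forall₂_congr (fun p hp => ?_))
      have h3 : (p:ℤ) ∣ m := by exact_mod_cast Finset.dvd_prod_of_mem _ hp
      exact (hP _ _ _ (h2.of_dvd h3)).dvd_iff)
  have hc : ((Finset.range (W * m)).filter (fun x : ℕ => (x:ℤ) % (W:ℤ) = v0 % (W:ℤ) ∧ ∀ p ∈ s, (p:ℤ) ∣ P x)).card
      = ∏ p ∈ s, ((Finset.range p).filter (fun x : ℕ => (p:ℤ) ∣ P x)).card := by
    rw [card_crt W m hW hm0, card_primes P hP s hs]
    · have : (Finset.range W).filter (fun x : ℕ => (x:ℤ) % (W:ℤ) = v0 % (W:ℤ)) = {(v0 % (W:ℤ)).toNat} := by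
        ext x
        simp only [Finset.mem_filter, Finset.mem_range, Finset.mem_singleton]
        have e0 := Int.emod_nonneg v0 hWz.ne'
        have e2 := Int.emod_lt_of_pos v0 hWz
        constructor
        · rintro ⟨h1, h2⟩
          rw [Int.emod_eq_of_lt (by positivity) (by exact_mod_cast h1)] at h2
          omega
        · rintro rfl
          rw [Int.toNat_of_nonneg e0]
          exact ⟨by omega, Int.emod_emod _ _⟩
      rw [this]; simp
    · exact (Nat.Coprime.prod_left hsW).symm
    · intro x; simp
    · intro x
      refine forall₂_congr (fun p hp => ?_)
      have h3 : p ∣ m := Finset.dvd_prod_of_mem _ hp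
      have : ((x % m : ℕ) : ℤ) ≡ x [ZMOD p] := by
        rw [Int.natCast_modEq_iff]
        exact (Nat.mod_modEq x m).of_dvd h3
      exact (hP _ _ _ this).dvd_iff
  rw [hc] at h
  have e : X / W * ∏ p ∈ s, (((Finset.range p).filter (fun x : ℕ => (p:ℤ) ∣ P x)).card : ℝ) / p =
     X / ((W * m : ℕ) : ℝ) * ((∏ p ∈ s, ((Finset.range p).filter (fun x : ℕ => (p:ℤ) ∣ P x)).card : ℕ) : ℝ) := by
    rw [Finset.prod_div_distrib, hm]
    push_cast
    rw [div_mul_div_comm, div_mul_eq_mul_div]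
  rw [e]
  exact_mod_cast h

lemma nu_le (k p : ℕ) (hp : p.Prime) (a b : Fin k → ℤ) (ha : ∀ i, ¬ (p:ℤ) ∣ a i) :
    ((Finset.range p).filter (fun x : ℕ => (p:ℤ) ∣ ∏ i, (a i * (x:ℤ) + b i))).card ≤ k := by
  classical
  have hp' : Prime (p:ℤ) := Nat.prime_iff_prime_int.1 hp
  calc _ ≤ ((Finset.univ : Finset (Fin k)).biUnion (fun i =>
        (Finset.range p).filter (fun x : ℕ => (p:ℤ) ∣ a i * (x:ℤ) + b i))).card := by
        apply Finset.card_le_card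
        intro x hx
        simp only [Finset.mem_filter, Finset.mem_biUnion, Finset.mem_univ, true_and] at hx ⊢
        obtain ⟨i, _, hi⟩ := (Prime.dvd_finsetProd_iff hp' _).1 hx.2
        exact ⟨i, hx.1, hi⟩
    _ ≤ ∑ i : Fin k, 1 := by
        refine Finset.card_biUnion_le.trans (Finset.sum_le_sum (fun i _ => ?_))
        rw [Finset.card_le_one]
        intro x hx y hy
        simp only [Finset.mem_filter, Finset.mem_range] at hx hy
        have h1 := dvd_sub hx.2 hy.2
        have h2 : (p:ℤ) ∣ a i * ((x:ℤ) - y) := by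
          have e : a i * (x:ℤ) + b i - (a i * (y:ℤ) + b i) = a i * ((x:ℤ) - y) := by ring
          rwa [e] at h1
        have h3 := (hp'.dvd_or_dvd h2).resolve_left (ha i)
        have h4 : (y:ℤ) ≡ x [ZMOD p] := (Int.modEq_iff_dvd).2 h3
        rw [Int.natCast_modEq_iff] at h4
        exact (h4.eq_of_lt_of_lt hy.1 hx.1).symm
    _ = k := by simp

lemma sqf_dvd_iff (d : ℕ) (hd : Squarefree d) (z : ℤ) :
    (d:ℤ) ∣ z ↔ ∀ p ∈ d.primeFactors, (p:ℤ) ∣ z := by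
  constructor
  · intro h p hp
    exact (Int.natCast_dvd_natCast.2 (Nat.dvd_of_mem_primeFactors hp)).trans h
  · intro h
    rw [Int.natCast_dvd]
    rw [← Nat.prod_primeFactors_of_squarefree hd]
    apply Finset.prod_primes_dvd
    · intro p hp; exact (Nat.prime_of_mem_primeFactors hp).prime
    · intro p hp; exact Int.natCast_dvd.1 (h p hp)

theorem sieve_weight_sum_asymptotic :
    ∀ ε : ℝ, 0 < ε → ∃ C : ℝ, 0 < C ∧ ∃ X0 : ℝ, ∀ X : ℝ, X0 ≤ X →
    ∀ (k p0 W : ℕ) (a b : Fin k → ℤ) (ν : ℕ → ℕ) (v0 : ℤ) (lam : ℕ → ℝ) (w : ℤ → ℝ),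
    -- sieve setup
    0 < k → (k : ℝ) ≤ Real.log X ^ ((1 : ℝ) / 5) →
    p0.Prime → Real.log (Real.log X) / 2 ≤ (p0 : ℝ) → (p0 : ℝ) ≤ X →
    W = ∏ p ∈ (Finset.range (⌊2 * Real.log X ^ ((1 : ℝ) / 3)⌋₊ + 1)).filter
          (fun p : ℕ => p.Prime ∧ (p : ℝ) ≤ 2 * Real.log X ^ ((1 : ℝ) / 3) ∧ p % 4 = 3 ∧ p ≠ p0), p →
    Function.Injective (fun i => (a i, b i)) →
    (∀ p : ℕ, p.Prime → p % 4 = 3 → ∃ n : ℤ, Int.gcd (∏ i, (a i * n + b i)) (p : ℤ) = 1) →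
    (∀ i, 0 < a i ∧ (a i : ℝ) ≤ Real.log X ^ ((1 : ℝ) / 3) ∧
      Int.gcd (2 * (p0 : ℤ)) (a i) = 1 ∧ 0 < b i ∧ (b i : ℝ) < X) →
    (∀ p : ℕ, p.Prime →
      ν p = ({n : ℕ | n < p ∧ (p : ℤ) ∣ ∏ i, (a i * (n : ℤ) + b i)}).ncard) →
    Int.gcd (∏ i, (a i * v0 + b i)) (W : ℤ) = 1 →
    (∀ d : ℕ, ¬(Squarefree d ∧ (d : ℝ) < X ^ ((1 : ℝ) / 10) ∧ InP3 d ∧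
      Nat.Coprime d (p0 * W)) → lam d = 0) →
    (∀ d : ℕ, |lam d| ≤ Real.log X ^ ((k : ℝ) / 2)) →
    (∀ n : ℤ, w n = if n % (W : ℤ) = v0 % (W : ℤ) then
        (∑ d ∈ (∏ i, (a i * n + b i)).natAbs.divisors, lam d) ^ 2 else 0) →
    -- conclusion
    |(∑ n ∈ (Finset.Icc (⌊X⌋ + 1) ⌊2 * X⌋).filter (fun n => n % (W : ℤ) = v0 % (W : ℤ)), w n) -
        (X / (W : ℝ)) * ∑ d ∈ Finset.range (⌊X ^ ((1 : ℝ) / 10)⌋₊ + 1),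
          ∑ e ∈ Finset.range (⌊X ^ ((1 : ℝ) / 10)⌋₊ + 1),
            lam d * lam e * ∏ p ∈ (d * e).primeFactors, (ν p : ℝ) / (p : ℝ)| ≤
      C * X ^ ((1 : ℝ) / 5 + ε) := by
  intro ε hε
  obtain ⟨X0, hX01, hX0⟩ := analytic ε hε
  refine ⟨1, one_pos, X0, ?_⟩
  intro X hX k p0 W a b ν v0 lam w hk hkL hp0 _ _ hWdef _ _ hab hν _ hlam hlamb hw
  obtain ⟨hL1, hfin⟩ := hX0 X hX
  have hfin := hfin k hkL
  have hX1 : 1 ≤ X := hX01.trans hX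
  classical
  set L := Real.log X with hLdef
  set D := ⌊X ^ ((1 : ℝ) / 10)⌋₊ with hD
  set P : ℤ → ℤ := fun n => ∏ i, (a i * n + b i) with hPdef
  have hP : ∀ (m : ℤ) x y, x ≡ y [ZMOD m] → P x ≡ P y [ZMOD m] := by
    intro m x y h
    rw [Int.modEq_iff_dvd] at h ⊢
    rw [← Int.modEq_iff_dvd] at h ⊢
    exact Int.ModEq.prod (fun i _ => (h.mul_left _).add_right _)
  have hW : 0 < W := by
    rw [hWdef]
    refine Finset.prod_pos (fun p hp => ?_)
    exact (Finset.mem_filter.1 hp).2.1.pos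
  have hν' : ∀ p : ℕ, p.Prime → ν p = ((Finset.range p).filter (fun x : ℕ => (p:ℤ) ∣ P x)).card := by
    intro p hp
    rw [hν p hp, ← Set.ncard_coe_finset]
    congr 1
    ext x; simp [hPdef]
  -- primes dividing good d
  have hgood : ∀ d, lam d ≠ 0 → Squarefree d ∧ d ∈ Finset.Icc 1 D ∧
      ∀ p ∈ d.primeFactors, p.Coprime W ∧ ν p ≤ k := by
    intro d hd
    obtain ⟨h1, h2, h3, h4⟩ := not_imp_comm.1 (hlam d) hd
    refine ⟨h1, ?_, ?_⟩
    · rw [Finset.mem_Icc]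
      exact ⟨Nat.pos_of_ne_zero h1.ne_zero, Nat.le_floor h2.le⟩
    · intro p hp
      have hpp := Nat.prime_of_mem_primeFactors hp
      have hpd := Nat.dvd_of_mem_primeFactors hp
      have hc : p.Coprime (p0 * W) := h4.coprime_dvd_left hpd
      have hcW : p.Coprime W := hc.coprime_dvd_right (dvd_mul_left _ _)
      refine ⟨hcW, ?_⟩
      rw [hν' p hpp]
      apply nu_le k p hpp
      intro i hi
      have hne : p ≠ p0 := by
        rintro rfl
        have := hc.coprime_dvd_right (dvd_mul_right p W)
        rw [Nat.coprime_self] at this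
        exact hpp.one_lt.ne' this
      have hlt : 2 * L ^ ((1:ℝ)/3) < p := by
        by_contra hcon
        push Not at hcon
        have : p ∣ W := by
          rw [hWdef]
          apply Finset.dvd_prod_of_mem
          simp only [Finset.mem_filter, Finset.mem_range]
          exact ⟨Nat.lt_succ_of_le (Nat.le_floor hcon), hpp, hcon, h3 p hpp hpd, hne⟩
        exact hpp.one_lt.ne' (Nat.Coprime.eq_one_of_dvd hcW this)
      obtain ⟨ha0, haL, -⟩ := hab i
      have h5 : (p:ℤ) ≤ a i := Int.le_of_dvd ha0 hi
      have h6 : (p:ℝ) ≤ a i := by exact_mod_cast h5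
      have h7 : 0 ≤ L ^ ((1:ℝ)/3) := by positivity
      linarith
  -- expansion
  set I := Finset.Icc (⌊X⌋ + 1) ⌊2 * X⌋ with hI
  set R := Finset.range (D + 1) with hR
  set cnt : ℕ → ℕ → ℝ := fun d e =>
    ((I.filter (fun n => n % (W:ℤ) = v0 % (W:ℤ) ∧ ((d:ℤ) ∣ P n ∧ (e:ℤ) ∣ P n))).card : ℝ) with hcnt
  have hexp : (∑ n ∈ I.filter (fun n => n % (W : ℤ) = v0 % (W : ℤ)), w n) =
      ∑ d ∈ R, ∑ e ∈ R, lam d * lam e * cnt d e := by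
    have h1 : ∀ n ∈ I.filter (fun n => n % (W : ℤ) = v0 % (W : ℤ)), w n =
       ∑ d ∈ R, ∑ e ∈ R, lam d * lam e * (if (d:ℤ) ∣ P n ∧ (e:ℤ) ∣ P n then 1 else 0) := by
      intro n hn
      rw [Finset.mem_filter, hI, Finset.mem_Icc] at hn
      have hn0 : 0 < n := by
        have : 0 ≤ ⌊X⌋ := Int.floor_nonneg.2 (by linarith)
        omega
      have hPn : P n ≠ 0 := by
        apply Finset.prod_ne_zero_iff.2
        intro i _
        have := hab i
        have h1 := mul_pos this.1 hn0
        linarith [this.2.2.2.1]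
      rw [hw n, if_pos hn.2]
      have : ∑ d ∈ (∏ i, (a i * n + b i)).natAbs.divisors, lam d =
          ∑ d ∈ R, if (d:ℤ) ∣ P n then lam d else 0 := by
        rw [← Finset.sum_filter]
        apply Finset.sum_congr_of_eq_on_inter
        · intro d h1 h2
          by_contra h0
          apply h2
          have := (hgood d h0).2.1
          rw [Finset.mem_Icc] at this
          rw [Finset.mem_filter, hR, Finset.mem_range]
          exact ⟨by omega, Int.natCast_dvd.2 (Nat.dvd_of_mem_divisors h1)⟩
        · intro d h1 h2
          exfalso; apply h2
          rw [Finset.mem_filter] at h1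
          rw [Nat.mem_divisors]
          exact ⟨Int.natCast_dvd.1 h1.2, Int.natAbs_ne_zero.2 hPn⟩
        · intros; rfl
      rw [this, sq, Finset.sum_mul_sum]
      refine Finset.sum_congr rfl (fun d _ => Finset.sum_congr rfl (fun e _ => ?_))
      by_cases h1 : (d:ℤ) ∣ P n <;> by_cases h2 : (e:ℤ) ∣ P n <;> simp [h1, h2]
    rw [Finset.sum_congr rfl h1, Finset.sum_comm]
    refine Finset.sum_congr rfl (fun d _ => ?_)
    rw [Finset.sum_comm]
    refine Finset.sum_congr rfl (fun e _ => ?_)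
    rw [← Finset.mul_sum, Finset.sum_boole, Finset.filter_filter]
  rw [hexp, Finset.mul_sum, ← Finset.sum_sub_distrib]
  -- termwise bound
  set g : ℕ → ℝ := fun d => if Squarefree d ∧ d ∈ Finset.Icc 1 D then (k:ℝ) ^ d.primeFactors.card else 0 with hg
  have hk1 : (1:ℝ) ≤ k := by exact_mod_cast hk
  have hg0 : ∀ d, 0 ≤ g d := by
    intro d; simp only [hg]; split_ifs <;> positivity
  have hL0 : 0 < L := by linarith
  have hterm : ∀ d e, |lam d * lam e * cnt d e -
      X / W * (lam d * lam e * ∏ p ∈ (d * e).primeFactors, (ν p : ℝ) / (p : ℝ))| ≤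
      L ^ k * (g d * g e) := by
    intro d e
    by_cases hd : lam d = 0
    · simp only [hd, zero_mul, mul_zero, sub_zero, abs_zero]
      have := hg0 d; have := hg0 e; positivity
    by_cases he : lam e = 0
    · simp only [he, zero_mul, mul_zero, sub_zero, abs_zero]
      have := hg0 d; have := hg0 e; positivity
    obtain ⟨d1, d2, d3⟩ := hgood d hd
    obtain ⟨e1, e2, e3⟩ := hgood e he
    have hgd : g d = (k:ℝ) ^ d.primeFactors.card := if_pos ⟨d1, d2⟩
    have hge : g e = (k:ℝ) ^ e.primeFactors.card := if_pos ⟨e1, e2⟩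
    have hun : (d * e).primeFactors = d.primeFactors ∪ e.primeFactors :=
      Nat.primeFactors_mul d1.ne_zero e1.ne_zero
    have hs : ∀ p ∈ (d * e).primeFactors, p.Coprime W ∧ ν p ≤ k := by
      intro p hp
      rw [hun, Finset.mem_union] at hp
      exact hp.elim (d3 p) (e3 p)
    have hpr : ∀ p ∈ (d * e).primeFactors, p.Prime := fun p hp => Nat.prime_of_mem_primeFactors hp
    have hmain := pair_count X (by linarith) P hP (d * e).primeFactors hpr W hW (fun p hp => (hs p hp).1) v0
    have hc : cnt d e = (((Finset.Icc (⌊X⌋ + 1) ⌊2 * X⌋).filter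
        (fun n => n % (W:ℤ) = v0 % (W:ℤ) ∧ ∀ p ∈ (d * e).primeFactors, (p:ℤ) ∣ P n)).card : ℝ) := by
      simp only [hcnt, hI]
      congr 2
      apply Finset.filter_congr
      intro n _
      rw [sqf_dvd_iff d d1, sqf_dvd_iff e e1, hun, Finset.forall_mem_union]
    rw [← hc] at hmain
    have q1 : ∏ p ∈ (d * e).primeFactors, (((Finset.range p).filter (fun x : ℕ => (p:ℤ) ∣ P x)).card : ℝ) / p
       = ∏ p ∈ (d * e).primeFactors, (ν p : ℝ) / (p : ℝ) :=
      Finset.prod_congr rfl (fun p hp => by rw [hν' p (hpr p hp)])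
    rw [q1] at hmain
    have q2 : ∏ p ∈ (d * e).primeFactors, (((Finset.range p).filter (fun x : ℕ => (p:ℤ) ∣ P x)).card : ℝ)
       ≤ g d * g e := by
      calc _ ≤ ∏ p ∈ (d * e).primeFactors, (k:ℝ) := by
            apply Finset.prod_le_prod
            · intros; positivity
            · intro p hp
              rw [← hν' p (hpr p hp)]
              exact_mod_cast (hs p hp).2
        _ ≤ _ := by
            rw [Finset.prod_const, hgd, hge, ← pow_add, hun]
            exact pow_le_pow_right₀ hk1 (Finset.card_union_le _ _)
    have q3 : lam d * lam e * cnt d e -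
      X / W * (lam d * lam e * ∏ p ∈ (d * e).primeFactors, (ν p : ℝ) / (p : ℝ)) =
      (lam d * lam e) * (cnt d e - X / W * ∏ p ∈ (d * e).primeFactors, (ν p : ℝ) / (p : ℝ)) := by ring
    rw [q3, abs_mul, abs_mul]
    have q4 : |lam d| * |lam e| ≤ L ^ k := by
      calc _ ≤ L ^ ((k:ℝ)/2) * L ^ ((k:ℝ)/2) :=
            mul_le_mul (hlamb d) (hlamb e) (abs_nonneg _) (by positivity)
        _ = L ^ k := by
            rw [← Real.rpow_add hL0, add_halves, Real.rpow_natCast]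
    exact mul_le_mul q4 (hmain.trans q2) (abs_nonneg _) (by positivity)
  have hgsum : ∑ d ∈ R, g d ≤ X ^ ((1:ℝ)/10) * (1 + L) ^ k := by
    have e1 : ∑ d ∈ R, g d = ∑ d ∈ (Finset.Icc 1 D).filter Squarefree, (k : ℝ) ^ d.primeFactors.card := by
      simp only [hg]
      rw [← Finset.sum_filter]
      apply Finset.sum_congr _ (fun _ _ => rfl)
      ext d
      simp only [hR, Finset.mem_filter, Finset.mem_range, Finset.mem_Icc]
      constructor
      · rintro ⟨_, h1, h2⟩; exact ⟨h2, h1⟩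
      · rintro ⟨h2, h1⟩; exact ⟨by omega, h1, h2⟩
    rw [e1]
    refine (sum_omega D k).trans ?_
    have hDX : (D:ℝ) ≤ X ^ ((1:ℝ)/10) := Nat.floor_le (by positivity)
    have hX10 : X ^ ((1:ℝ)/10) ≤ X := by
      conv_rhs => rw [← Real.rpow_one X]
      exact Real.rpow_le_rpow_of_exponent_le hX1 (by norm_num)
    have hD1 : 1 ≤ D := Nat.le_floor (by simpa using Real.one_le_rpow hX1 (by norm_num))
    have hD1' : (1:ℝ) ≤ D := by exact_mod_cast hD1
    have hlog : Real.log D ≤ L := Real.log_le_log (by linarith) (hDX.trans hX10)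
    have hlog0 : 0 ≤ Real.log D := Real.log_nonneg hD1'
    gcongr
  have hgs0 : 0 ≤ ∑ d ∈ R, g d := Finset.sum_nonneg (fun d _ => hg0 d)
  calc _ ≤ ∑ d ∈ R, ∑ e ∈ R, L ^ k * (g d * g e) := by
        refine (Finset.abs_sum_le_sum_abs _ _).trans (Finset.sum_le_sum (fun d _ => ?_))
        rw [Finset.mul_sum, ← Finset.sum_sub_distrib]
        exact (Finset.abs_sum_le_sum_abs _ _).trans (Finset.sum_le_sum (fun e _ => hterm d e))
    _ = L ^ k * (∑ d ∈ R, g d) ^ 2 := by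
        simp_rw [← Finset.mul_sum]
        rw [← Finset.sum_mul, sq]
    _ ≤ L ^ k * (X ^ ((1:ℝ)/10) * (1 + L) ^ k) ^ 2 := by gcongr
    _ = X ^ ((1:ℝ)/5) * (L ^ k * ((1 + L) ^ k) ^ 2) := by
        have : X ^ ((1:ℝ)/5) = (X ^ ((1:ℝ)/10)) ^ 2 := by
          rw [← Real.rpow_natCast, ← Real.rpow_mul (by linarith)]; norm_num
        rw [this]; ring
    _ ≤ X ^ ((1:ℝ)/5) * X ^ ε := by gcongr
    _ = 1 * X ^ ((1 : ℝ) / 5 + ε) := by rw [Real.rpow_add (by linarith), one_mul]
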